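/- arXiv:2206.04646 — 3 statements merged into one kernel-verified Lean document; each statement's English description precedes it below -/
import Mathlib

section
/- For every B ∈ ℕ, R^go_B ≤ R^go. -/
open MeasureTheory Filter Set
open scoped ENNReal NNReal

noncomputable section

/-- KL divergence between Bernoulli distributions with means `q` and `p`
(conventions: `0·log(0/x) = 0`, and the divergence is `∞` if `p ∈ {0,1}` and `q ≠ p`). -/
def klBer (q p : ℝ) : ℝ≥0∞ :=
  if (p = 0 ∧ q ≠ 0) ∨ (p = 1 ∧ q ≠ 1) then ⊤
  else ENNReal.ofReal (q * Real.log (q / p) + (1 - q) * Real.log ((1 - q) / (1 - p)))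

/-- The probability simplex `Δ_K`. -/
def probSimplex (K : ℕ) : Set (Fin K → ℝ) := {r | (∀ i, 0 ≤ r i) ∧ ∑ i, r i = 1}

/-- The set of best arms `I*(P) = {i : P i = max_j P j}`. -/
def bestArms {K : ℕ} (P : Fin K → ℝ) : Set (Fin K) := {i | ∀ j, P j ≤ P i}

/-- The rate `R^go`. -/
def Rgo (K : ℕ) (H : (Fin K → ℝ) → ℝ≥0∞) : ℝ≥0∞ :=
  ⨆ (r : (Fin K → ℝ) → Fin K → ℝ) (_ : ∀ Q, r Q ∈ probSimplex K)
    (J : (Fin K → ℝ) → Fin K),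
    ⨅ (Q : Fin K → ℝ) (_ : ∀ i, Q i ∈ Icc (0 : ℝ) 1)
      (P : Fin K → ℝ) (_ : ∀ i, P i ∈ Icc (0 : ℝ) 1)
      (_ : J Q ∉ bestArms P),
      H P * ∑ i, ENNReal.ofReal (r Q i) * klBer (Q i) (P i)

/-- The inner objective of the `R^go_B` optimization problem, for a fixed tuple of
allocation functions `rB` (where `rB b` is the allocation of batch `b+1` as a function of
the empirical means of the first `b+1` batches) and recommendation function `J`. -/
def batchObj (K B : ℕ) (H : (Fin K → ℝ) → ℝ≥0∞)
    (rB : (b : ℕ) → (Fin (b + 1) → Fin K → ℝ) → Fin K → ℝ)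
    (J : (Fin B → Fin K → ℝ) → Fin K) : ℝ≥0∞ :=
  ⨅ (Qs : Fin B → Fin K → ℝ) (_ : ∀ b i, Qs b i ∈ Icc (0 : ℝ) 1)
    (P : Fin K → ℝ) (_ : ∀ i, P i ∈ Icc (0 : ℝ) 1)
    (_ : J Qs ∉ bestArms P),
    (H P / B) * ∑ b : Fin B, ∑ i,
      ENNReal.ofReal (rB b.1 (fun j => Qs (Fin.castLE b.isLt j)) i) * klBer (Qs b i) (P i)

/-- The rate `R^go_B` for `B` batches. -/
def RgoB (K B : ℕ) (H : (Fin K → ℝ) → ℝ≥0∞) : ℝ≥0∞ :=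
  ⨆ (rB : (b : ℕ) → (Fin (b + 1) → Fin K → ℝ) → Fin K → ℝ)
    (_ : ∀ b Qs, rB b Qs ∈ probSimplex K)
    (J : (Fin B → Fin K → ℝ) → Fin K),
    batchObj K B H rB J

/-- Averaging finitely many points of the simplex stays in the simplex. -/
lemma average_mem_probSimplex {K B : ℕ} (hB : B ≠ 0) {r : Fin B → Fin K → ℝ}
    (hr : ∀ b, r b ∈ probSimplex K) :
    (fun i => (B : ℝ)⁻¹ * ∑ b, r b i) ∈ probSimplex K := by
  refine ⟨fun i => mul_nonneg (by positivity) (Finset.sum_nonneg fun b _ => (hr b).1 i), ?_⟩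
  rw [← Finset.mul_sum, Finset.sum_comm]
  simp [(hr _).2, hB]

/-- The cost of the averaged allocation is the average of the costs. -/
lemma sum_ofReal_average_mul {K B : ℕ} (hB : B ≠ 0) {r : Fin B → Fin K → ℝ}
    (hr : ∀ b i, 0 ≤ r b i) (d : Fin K → ℝ≥0∞) :
    ∑ i, ENNReal.ofReal ((B : ℝ)⁻¹ * ∑ b, r b i) * d i =
      (B : ℝ≥0∞)⁻¹ * ∑ b, ∑ i, ENNReal.ofReal (r b i) * d i := by
  rw [Finset.sum_comm, Finset.mul_sum]
  refine Finset.sum_congr rfl fun i _ => ?_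
  rw [ENNReal.ofReal_mul (by positivity), ENNReal.ofReal_inv_of_pos (by positivity),
    ENNReal.ofReal_natCast, ENNReal.ofReal_sum_of_nonneg fun b _ => hr b i, mul_assoc,
    Finset.sum_mul]

/-- Corollary 1: `R^go_B ≤ R^go` for any number of batches `B ≥ 1`. -/
theorem RgoB_le_Rgo (K B : ℕ) (hB : 1 ≤ B) (H : (Fin K → ℝ) → ℝ≥0∞)
    (hH : ∀ P : Fin K → ℝ, (∀ i, P i ∈ Icc (0 : ℝ) 1) → 0 < H P) :
    RgoB K B H ≤ Rgo K H := by
  have hB0 : B ≠ 0 := by omega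
  refine iSup_le fun rB => iSup_le fun hr => iSup_le fun J => ?_
  -- Run the batched strategy as if every batch had returned the same empirical means.
  refine le_iSup_of_le (fun Q i => (B : ℝ)⁻¹ * ∑ b : Fin B, rB b.1 (fun _ => Q) i) <|
    le_iSup_of_le (fun Q => average_mem_probSimplex hB0 fun b => hr b.1 fun _ => Q) <|
    le_iSup_of_le (fun Q => J fun _ => Q) ?_
  refine le_iInf fun Q => le_iInf fun hQ => le_iInf fun P => le_iInf fun hP =>
    le_iInf fun hJ => ?_
  refine iInf_le_of_le (fun _ => Q) <| iInf_le_of_le (fun _ => hQ) <| iInf_le_of_le P <|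
    iInf_le_of_le hP <| iInf_le_of_le hJ ?_
  rw [sum_ofReal_average_mul hB0 (fun b => (hr b.1 fun _ => Q).1), ← mul_assoc, div_eq_mul_inv]

end
end

section
/- With the allocations r_b and stored means Q'_a generated by the DOT recursion from arbitrary batch empirical means Q_1,…,Q_{B+K−1} ∈ [0,1]^K, for every P ∈ [0,1]^K and every B_C ∈ {K, K+1, …, B+K−1} one has Σ_{b=1}^{B_C} Σ_{i=1}^K r_{b,i}·d(Q_{b,i}, P_i) ≥ Σ_{a=1}^{B_C−K} Σ_{i=1}^K r*_{a,i}(Q'_1,…,Q'_a)·d(Q'_{a,i}, P_i) + Σ_{i=1}^K d(Q'_{B_C−K+1,i}, P_i). -/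
open MeasureTheory Filter Set
open scoped ENNReal NNReal

noncomputable section

/-- The stored empirical means `Q'` of the DOT algorithm (0-indexed: `Qstored a = Q'_{a+1}`),
generated by the DOT recursion from batch empirical means `Q` (0-indexed: `Q b = Q_{b+1}`)
and the allocation functions `rstar` (0-indexed: `rstar b = r*_{b+1}`). -/
def Qstored (K : ℕ) (rstar : (b : ℕ) → (Fin (b + 1) → Fin K → ℝ) → Fin K → ℝ)
    (Q : ℕ → Fin K → ℝ) : ℕ → Fin K → ℝ
  | 0 => fun i => Q i.1 i
  | a + 1 => fun i =>
      Qstored K rstar Q a i +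
        rstar a (fun j => Qstored K rstar Q j.1) i * (Q (a + K) i - Qstored K rstar Q a i)
  decreasing_by all_goals first | exact j.2 | exact Nat.lt_succ_self a

/-- The allocation of batch `b+1` (0-indexed `b`) used by the DOT algorithm:
the first `K` batches are uniform exploration (batch `b` draws only arm `b`), and
afterwards the allocation is the `rstar` allocation evaluated at the stored means. -/
def dotAlloc (K : ℕ) (rstar : (b : ℕ) → (Fin (b + 1) → Fin K → ℝ) → Fin K → ℝ)
    (Q : ℕ → Fin K → ℝ) (b : ℕ) : Fin K → ℝ :=
  if b < K then fun i => if i.1 = b then 1 else 0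
  else rstar (b - K) fun j => Qstored K rstar Q j.1

/-- Each summand of the Bernoulli divergence is convex in its first argument. -/
theorem convexOn_mul_log_div {p : ℝ} (hp : 0 < p) :
    ConvexOn ℝ (Ici 0) fun q : ℝ => q * Real.log (q / p) := by
  refine ⟨convex_Ici 0, fun x hx y hy a b ha hb hab => ?_⟩
  have h := Real.convexOn_mul_log.2 (mem_Ici.2 (div_nonneg hx hp.le))
    (mem_Ici.2 (div_nonneg hy hp.le)) ha hb hab
  simp only [smul_eq_mul] at h ⊢
  have hc : (a * x + b * y) / p = a * (x / p) + b * (y / p) := by ring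
  rw [hc]
  calc _ = p * ((a * (x / p) + b * (y / p)) * Real.log (a * (x / p) + b * (y / p))) := by
        field_simp
    _ ≤ p * (a * (x / p * Real.log (x / p)) + b * (y / p * Real.log (y / p))) := by gcongr
    _ = _ := by field_simp

theorem klBer_convex_combination_le {p x y a b : ℝ} (hp : p ∈ Icc (0 : ℝ) 1)
    (hx : x ∈ Icc (0 : ℝ) 1) (hy : y ∈ Icc (0 : ℝ) 1) (ha : 0 ≤ a) (hb : 0 ≤ b)
    (hab : a + b = 1) :
    klBer (a * x + b * y) p ≤ ENNReal.ofReal a * klBer x p + ENNReal.ofReal b * klBer y p := by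
  rcases ha.eq_or_lt with rfl | ha'
  · obtain rfl : b = 1 := by linarith
    simp
  rcases hb.eq_or_lt with rfl | hb'
  · obtain rfl : a = 1 := by linarith
    simp
  by_cases hxt : (p = 0 ∧ x ≠ 0) ∨ (p = 1 ∧ x ≠ 1)
  · have : klBer x p = ⊤ := if_pos hxt
    simp [this, ENNReal.mul_top, ha']
  by_cases hyt : (p = 0 ∧ y ≠ 0) ∨ (p = 1 ∧ y ≠ 1)
  · have : klBer y p = ⊤ := if_pos hyt
    simp [this, ENNReal.mul_top, hb']
  rcases hp.1.eq_or_lt with rfl | hp0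
  · obtain rfl : x = 0 := by simpa using hxt
    obtain rfl : y = 0 := by simpa using hyt
    simp [klBer]
  rcases hp.2.eq_or_lt with rfl | hp1
  · obtain rfl : x = 1 := by simpa using hxt
    obtain rfl : y = 1 := by simpa using hyt
    simp [klBer, hab]
  simp only [klBer, hp0.ne', hp1.ne, false_and, or_self, if_false]
  rw [← ENNReal.ofReal_mul ha, ← ENNReal.ofReal_mul hb]
  refine (ENNReal.ofReal_le_ofReal ?_).trans ENNReal.ofReal_add_le
  have h₀ := (convexOn_mul_log_div hp0).2 hx.1 hy.1 ha hb hab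
  have h₁ := (convexOn_mul_log_div (sub_pos.2 hp1)).2 (mem_Ici.2 (sub_nonneg.2 hx.2))
    (mem_Ici.2 (sub_nonneg.2 hy.2)) ha hb hab
  simp only [smul_eq_mul] at h₀ h₁
  have hc : 1 - (a * x + b * y) = a * (1 - x) + b * (1 - y) := by linear_combination -hab
  rw [hc]
  linarith

theorem le_one_of_mem_probSimplex {K : ℕ} {r : Fin K → ℝ} (hr : r ∈ probSimplex K) (i : Fin K) :
    r i ≤ 1 :=
  hr.2 ▸ Finset.single_le_sum (fun j _ => hr.1 j) (Finset.mem_univ i)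

theorem Qstored_succ (K : ℕ) (rstar : (b : ℕ) → (Fin (b + 1) → Fin K → ℝ) → Fin K → ℝ)
    (Q : ℕ → Fin K → ℝ) (a : ℕ) (i : Fin K) :
    Qstored K rstar Q (a + 1) i =
      (1 - rstar a (fun j => Qstored K rstar Q j.1) i) * Qstored K rstar Q a i +
        rstar a (fun j => Qstored K rstar Q j.1) i * Q (a + K) i := by
  rw [Qstored]
  ring

theorem Qstored_mem_Icc {K : ℕ} {rstar : (b : ℕ) → (Fin (b + 1) → Fin K → ℝ) → Fin K → ℝ}
    (hrstar : ∀ b Qs, rstar b Qs ∈ probSimplex K)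
    {Q : ℕ → Fin K → ℝ} (hQ : ∀ b i, Q b i ∈ Icc (0 : ℝ) 1) (a : ℕ) (i : Fin K) :
    Qstored K rstar Q a i ∈ Icc (0 : ℝ) 1 := by
  induction a with
  | zero => rw [Qstored]; exact hQ _ _
  | succ a ih =>
    rw [Qstored_succ]
    exact convex_Icc (0 : ℝ) 1 ih (hQ _ _)
      (sub_nonneg.2 (le_one_of_mem_probSimplex (hrstar _ _) i)) ((hrstar _ _).1 i) (by ring)

/-- One DOT update: convexity of the divergence trades the stored mean for the new batch. -/
theorem klBer_Qstored_succ_le {K : ℕ}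
    {rstar : (b : ℕ) → (Fin (b + 1) → Fin K → ℝ) → Fin K → ℝ}
    (hrstar : ∀ b Qs, rstar b Qs ∈ probSimplex K)
    {Q : ℕ → Fin K → ℝ} (hQ : ∀ b i, Q b i ∈ Icc (0 : ℝ) 1)
    {p : ℝ} (hp : p ∈ Icc (0 : ℝ) 1) (a : ℕ) (i : Fin K) :
    ENNReal.ofReal (rstar a (fun j => Qstored K rstar Q j.1) i) * klBer (Qstored K rstar Q a i) p
        + klBer (Qstored K rstar Q (a + 1) i) p
      ≤ klBer (Qstored K rstar Q a i) p +
        ENNReal.ofReal (rstar a (fun j => Qstored K rstar Q j.1) i) * klBer (Q (a + K) i) p := by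
  rw [Qstored_succ]
  set r := rstar a (fun j => Qstored K rstar Q j.1) i
  have h0 : 0 ≤ r := (hrstar _ _).1 i
  have h1 : 0 ≤ 1 - r := sub_nonneg.2 (le_one_of_mem_probSimplex (hrstar _ _) i)
  have hconv := klBer_convex_combination_le hp (Qstored_mem_Icc hrstar hQ a i) (hQ (a + K) i)
    h1 h0 (by ring)
  refine (add_le_add_right hconv _).trans_eq ?_
  rw [← add_assoc, ← add_mul, ← ENNReal.ofReal_add h0 h1]
  simp

theorem sum_dotAlloc_initial_batches (K : ℕ)
    (rstar : (b : ℕ) → (Fin (b + 1) → Fin K → ℝ) → Fin K → ℝ)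
    (Q : ℕ → Fin K → ℝ) (P : Fin K → ℝ) :
    ∑ b ∈ Finset.range K, ∑ i, ENNReal.ofReal (dotAlloc K rstar Q b i) * klBer (Q b i) (P i) =
      ∑ i, klBer (Qstored K rstar Q 0 i) (P i) := by
  rw [Finset.sum_range]
  refine Finset.sum_congr rfl fun b _ => ?_
  rw [Finset.sum_eq_single b]
  · simp [dotAlloc, Qstored]
  · intro i _ hi
    simp [dotAlloc, Fin.val_ne_iff.2 hi]
  · simp

/-- Lemma 4: with the allocations `r_b` and stored means `Q'_a` generated by the DOT
recursion, for every `P ∈ [0,1]^K` and every `B_C ∈ {K, …, B+K−1}`,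
`Σ_{b=1}^{B_C} Σ_i r_{b,i}·d(Q_{b,i},P_i)
  ≥ Σ_{a=1}^{B_C−K} Σ_i r*_{a,i}(Q'_1,…,Q'_a)·d(Q'_{a,i},P_i) + Σ_i d(Q'_{B_C−K+1,i},P_i)`. -/
theorem dot_stored_divergence_bound (K B : ℕ) (hK : 1 ≤ K) (hB : 1 ≤ B)
    (rstar : (b : ℕ) → (Fin (b + 1) → Fin K → ℝ) → Fin K → ℝ)
    (hrstar : ∀ b Qs, rstar b Qs ∈ probSimplex K)
    (Q : ℕ → Fin K → ℝ) (hQ : ∀ b i, Q b i ∈ Icc (0 : ℝ) 1)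
    (P : Fin K → ℝ) (hP : ∀ i, P i ∈ Icc (0 : ℝ) 1)
    (BC : ℕ) (hBC1 : K ≤ BC) (hBC2 : BC ≤ B + K - 1) :
    (∑ a ∈ Finset.range (BC - K), ∑ i,
        ENNReal.ofReal (rstar a (fun j => Qstored K rstar Q j.1) i) *
          klBer (Qstored K rstar Q a i) (P i))
      + ∑ i, klBer (Qstored K rstar Q (BC - K) i) (P i)
    ≤ ∑ b ∈ Finset.range BC, ∑ i,
        ENNReal.ofReal (dotAlloc K rstar Q b i) * klBer (Q b i) (P i) := by
  obtain ⟨n, rfl⟩ := Nat.exists_eq_add_of_le' hBC1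
  clear hBC1 hBC2
  rw [Nat.add_sub_cancel]
  induction n with
  | zero => simp [sum_dotAlloc_initial_batches]
  | succ n ih =>
    have hstep := Finset.sum_le_sum fun (i : Fin K) (_ : i ∈ Finset.univ) =>
      klBer_Qstored_succ_le hrstar hQ (hP i) n i
    simp only [Finset.sum_add_distrib] at hstep
    have halloc : dotAlloc K rstar Q (n + K) =
        rstar n fun j => Qstored K rstar Q j.1 := by
      rw [dotAlloc, if_neg (by omega), Nat.add_sub_cancel]
    rw [Nat.add_right_comm, Finset.sum_range_succ, Finset.sum_range_succ, halloc, add_assoc]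
    refine (add_le_add_right hstep _).trans ?_
    rw [← add_assoc]
    exact add_le_add_left ih _

end
end

section
/- For every ε ∈ (0, 0.1), setting P = (0.6, 0.5, 0.5−ε), the uniform allocation satisfies G((1/3, 1/3, 1/3); P) ≥ 1/600. -/
open MeasureTheory Filter Set
open scoped ENNReal NNReal

noncomputable section

/-- The set of alternative instances `Alt(P)`: instances `P' ∈ [0,1]³` having a best arm
that is not a best arm of `P`. -/
def altSet (P : Fin 3 → ℝ) : Set (Fin 3 → ℝ) :=
  {P' | (∀ i, P' i ∈ Icc (0 : ℝ) 1) ∧ ¬ bestArms P' ⊆ bestArms P}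

/-- `G(r; P) = inf_{P' ∈ Alt(P)} Σ_i r_i·d(P_i, P'_i)`. -/
def Gfun (r P : Fin 3 → ℝ) : ℝ≥0∞ :=
  ⨅ (P' : Fin 3 → ℝ) (_ : P' ∈ altSet P), ∑ i, ENNReal.ofReal (r i) * klBer (P i) (P' i)

theorem two_mul_sub_sqrt_mul_sqrt_le_mul_log {x y : ℝ} (hx : 0 < x) (hy : 0 < y) :
    2 * (x - √x * √y) ≤ x * Real.log (x / y) := by
  have hsx : 0 < √x := Real.sqrt_pos.2 hx
  have hsy : 0 < √y := Real.sqrt_pos.2 hy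
  have hlog : Real.log (x / y) = 2 * Real.log (√x / √y) := by
    rw [← Real.sqrt_div hx.le, Real.log_sqrt (div_pos hx hy).le]
    ring
  have h := Real.one_sub_inv_le_log_of_pos (div_pos hsx hsy)
  have hmul := mul_le_mul_of_nonneg_left h hx.le
  have hcancel : x * (√x / √y)⁻¹ = √x * √y := by
    nth_rewrite 1 [← Real.mul_self_sqrt hx.le]
    field_simp
  rw [mul_sub, hcancel] at hmul
  rw [hlog]
  linarith

theorem sq_sub_sq_sq_le {s t u v : ℝ} (hsu : s ^ 2 + u ^ 2 = 1) (htv : t ^ 2 + v ^ 2 = 1) :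
    (s ^ 2 - t ^ 2) ^ 2 ≤ 2 - 2 * (s * t + u * v) := by
  have hfac : s ^ 2 - t ^ 2 = (s * v - t * u) * (s * v + t * u) := by
    linear_combination t ^ 2 * hsu - s ^ 2 * htv
  have hsin : (s * v - t * u) ^ 2 = 1 - (s * t + u * v) ^ 2 := by
    linear_combination (t ^ 2 + v ^ 2) * hsu + htv
  have hle : (s * v + t * u) ^ 2 ≤ 1 := by
    have h : (s * v + t * u) ^ 2 = 1 - (s * t - u * v) ^ 2 := by
      linear_combination (t ^ 2 + v ^ 2) * hsu + htv
    nlinarith [sq_nonneg (s * t - u * v)]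
  calc (s ^ 2 - t ^ 2) ^ 2 = (s * v - t * u) ^ 2 * (s * v + t * u) ^ 2 := by rw [hfac, mul_pow]
    _ ≤ (s * v - t * u) ^ 2 := mul_le_of_le_one_right (sq_nonneg _) hle
    _ ≤ 2 - 2 * (s * t + u * v) := by nlinarith [sq_nonneg (s * t + u * v - 1)]

/-- A weak form of Pinsker's inequality for Bernoulli distributions. -/
theorem ofReal_sq_sub_le_klBer {q p : ℝ} (hq : q ∈ Ioo (0 : ℝ) 1) (hp : p ∈ Icc (0 : ℝ) 1) :
    ENNReal.ofReal ((q - p) ^ 2) ≤ klBer q p := by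
  unfold klBer
  split_ifs with h
  · exact le_top
  · have hp0 : 0 < p := lt_of_le_of_ne hp.1 fun e => h (Or.inl ⟨e.symm, hq.1.ne'⟩)
    have hp1 : p < 1 := lt_of_le_of_ne hp.2 fun e => h (Or.inr ⟨e, hq.2.ne⟩)
    have hq1 : 0 < 1 - q := sub_pos.2 hq.2
    have hp1' : 0 < 1 - p := sub_pos.2 hp1
    apply ENNReal.ofReal_le_ofReal
    have h₁ := two_mul_sub_sqrt_mul_sqrt_le_mul_log hq.1 hp0
    have h₂ := two_mul_sub_sqrt_mul_sqrt_le_mul_log hq1 hp1'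
    have h₃ := @sq_sub_sq_sq_le (√q) (√p) (√(1 - q)) (√(1 - p))
      (by rw [Real.sq_sqrt hq.1.le, Real.sq_sqrt hq1.le]; ring)
      (by rw [Real.sq_sqrt hp0.le, Real.sq_sqrt hp1'.le]; ring)
    rw [Real.sq_sqrt hq.1.le, Real.sq_sqrt hp0.le] at h₃
    linarith

theorem ofReal_le_mul_klBer_add_mul_klBer {q₀ q₁ p₀ p₁ : ℝ} (hq₀ : q₀ ∈ Ioo (0 : ℝ) 1)
    (hq₁ : q₁ ∈ Ioo (0 : ℝ) 1) (hp₀ : p₀ ∈ Icc (0 : ℝ) 1) (hp₁ : p₁ ∈ Icc (0 : ℝ) 1)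
    (hgap : q₁ + 1 / 10 ≤ q₀) (hle : p₀ ≤ p₁) :
    ENNReal.ofReal (1 / 600) ≤
      ENNReal.ofReal (1 / 3) * klBer q₀ p₀ + ENNReal.ofReal (1 / 3) * klBer q₁ p₁ := by
  calc ENNReal.ofReal (1 / 600)
      ≤ ENNReal.ofReal (1 / 3 * ((q₀ - p₀) ^ 2 + (q₁ - p₁) ^ 2)) := by
        apply ENNReal.ofReal_le_ofReal
        nlinarith [sq_nonneg ((q₀ - p₀) + (q₁ - p₁))]
    _ = ENNReal.ofReal (1 / 3) * ENNReal.ofReal ((q₀ - p₀) ^ 2) +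
          ENNReal.ofReal (1 / 3) * ENNReal.ofReal ((q₁ - p₁) ^ 2) := by
        rw [ENNReal.ofReal_mul (by norm_num), ENNReal.ofReal_add (sq_nonneg _) (sq_nonneg _),
          mul_add]
    _ ≤ _ := by
        gcongr
        · exact ofReal_sq_sub_le_klBer hq₀ hp₀
        · exact ofReal_sq_sub_le_klBer hq₁ hp₁

/-- For the instance `P = (0.6, 0.5, 0.5−ε)` with `ε ∈ (0, 0.1)`, the uniform allocation
satisfies `G((1/3,1/3,1/3); P) ≥ 1/600`. -/
theorem fc_uniform_lb_one (ε : ℝ) (hε : ε ∈ Ioo (0 : ℝ) 0.1) :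
    ENNReal.ofReal (1 / 600) ≤
      Gfun ![1 / 3, 1 / 3, 1 / 3] ![0.6, 0.5, 0.5 - ε] := by
  obtain ⟨hε0, hε1⟩ := hε
  norm_num at hε1
  refine le_iInf₂ fun P' ⟨hP', hbest⟩ => ?_
  obtain ⟨i, hi, hi'⟩ := Set.not_subset.1 hbest
  have hle : P' 0 ≤ P' i := hi 0
  rw [Fin.sum_univ_three]
  simp only [Matrix.cons_val]
  fin_cases i
  · refine absurd (fun j => ?_) hi'
    fin_cases j <;> norm_num
    linarith
  · refine le_trans ?_ le_self_add
    exact ofReal_le_mul_klBer_add_mul_klBer (by norm_num) (by norm_num) (hP' 0) (hP' 1)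
      (by norm_num) hle
  · rw [add_right_comm]
    refine le_trans ?_ le_self_add
    exact ofReal_le_mul_klBer_add_mul_klBer (by norm_num) (by constructor <;> linarith)
      (hP' 0) (hP' 2) (by linarith) hle

end
end
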